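/- arXiv:1212.5656 — 2 statements merged into one kernel-verified Lean document; each statement's English description precedes it below -/
import Mathlib

section
/- Let C be a point of the real projective space P^3 and let T be a continuous map from P^3 \ {C} to the real projective plane P^2 satisfying: (a) for any three points lying on a projective line of P^3 not containing C, their images under T are collinear in P^2; (b) for any two points (distinct from C) lying on a projective line of P^3 containing C, their images under T are equal; (c) there exist four points lying on a projective plane of P^3 not containing C, no three of which are collinear, whose images under T are such that no three of them are collinear. Then T is a pinhole camera with center C, i.e., there exists a surjective linear map L : R^4 -> R^3 whose kernel is the line of R^4 spanned by a representative vector of C, such that for every point p of P^3 other than C, T(p) is the projective point represented by L applied to any representative vector of p. -/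
open scoped LinearAlgebra.Projectivization
open Projectivization

/-- The quotient topology on a real projectivization, coinduced from the
nonzero vectors by the projection `Projectivization.mk'`. -/
noncomputable instance projTopology (V : Type*) [AddCommGroup V] [Module ℝ V]
    [TopologicalSpace V] : TopologicalSpace (ℙ ℝ V) :=
  TopologicalSpace.coinduced (Projectivization.mk' ℝ) inferInstance

/-- A set of points of a projectivization is *collinear* if all of them lie in a common
projective line, i.e. in the projectivization of a linear subspace of dimension at most 2. -/
def ProjCollinear {V : Type*} [AddCommGroup V] [Module ℝ V] (s : Set (ℙ ℝ V)) : Prop :=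
  ∃ W : Submodule ℝ V, Module.finrank ℝ W ≤ 2 ∧ ∀ p ∈ s, p.rep ∈ W

section FixedVectors

open scoped Matrix

theorem exists_smul_eq_of_cross_eq_zero {z w : Fin 3 → ℝ} (hz : z ≠ 0) (hw : w ≠ 0)
    (h : z ⨯₃ w = 0) : ∃ k : ℝ, k ≠ 0 ∧ w = k • z := by
  have hli : ¬ LinearIndependent ℝ ![z, w] := fun hli =>
    crossProduct_ne_zero_iff_linearIndependent.2 hli h
  rw [LinearIndependent.pair_iff' hz] at hli
  push Not at hli
  obtain ⟨k, rfl⟩ := hli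
  exact ⟨k, fun hk => hw (by simp [hk]), rfl⟩

theorem exists_smul_eq_of_dotProduct_eq_zero {m n z w : Fin 3 → ℝ} (hmn : m ⨯₃ n ≠ 0)
    (hz : z ≠ 0) (hw : w ≠ 0) (hzm : z ⬝ᵥ m = 0) (hzn : z ⬝ᵥ n = 0)
    (hwm : w ⬝ᵥ m = 0) (hwn : w ⬝ᵥ n = 0) : ∃ k : ℝ, k ≠ 0 ∧ w = k • z := by
  have key : ∀ v : Fin 3 → ℝ, v ≠ 0 → v ⬝ᵥ m = 0 → v ⬝ᵥ n = 0 →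
      ∃ k : ℝ, k ≠ 0 ∧ v = k • (m ⨯₃ n) := fun v hv hvm hvn =>
    exists_smul_eq_of_cross_eq_zero hmn hv (by
      rw [cross_cross_eq_smul_sub_smul, dotProduct_comm m v, dotProduct_comm n v, hvm, hvn]
      simp)
  obtain ⟨a, ha, hza⟩ := key z hz hzm hzn
  obtain ⟨b, hb, hwb⟩ := key w hw hwm hwn
  refine ⟨b / a, by positivity, ?_⟩
  rw [hza, hwb, smul_smul, div_mul_cancel₀ b ha]

/-- The vector `z` is sent by `r` to a nonzero multiple of itself. -/
def IsFixedVec (r : (Fin 3 → ℝ) → Fin 3 → ℝ) (z : Fin 3 → ℝ) : Prop :=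
  ∃ k : ℝ, k ≠ 0 ∧ r z = k • z

/-- The plane of vectors orthogonal to `m` is sent by `r` to itself. -/
def IsFixedLine (r : (Fin 3 → ℝ) → Fin 3 → ℝ) (m : Fin 3 → ℝ) : Prop :=
  ∀ z : Fin 3 → ℝ, z ≠ 0 → z ⬝ᵥ m = 0 → r z ⬝ᵥ m = 0

/-- The map `r` on vectors represents a map of the projective plane preserving collinearity. -/
structure IsLineation (r : (Fin 3 → ℝ) → Fin 3 → ℝ) : Prop where
  ne_zero : ∀ z, z ≠ 0 → r z ≠ 0
  dotProduct_cross : ∀ x y z, x ⨯₃ y ≠ 0 → z ≠ 0 → z ⬝ᵥ (x ⨯₃ y) = 0 →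
    r z ⬝ᵥ (r x ⨯₃ r y) = 0

variable {r : (Fin 3 → ℝ) → Fin 3 → ℝ}

theorem IsFixedVec.join (hr : IsLineation r) {x y : Fin 3 → ℝ} (m : Fin 3 → ℝ)
    (hx : IsFixedVec r x) (hy : IsFixedVec r y) (hxy : x ⨯₃ y ≠ 0) (hm : m ≠ 0)
    (hmx : m ⬝ᵥ x = 0) (hmy : m ⬝ᵥ y = 0) : IsFixedLine r m := by
  intro z hz hzm
  obtain ⟨a, ha, hxa⟩ := hx
  obtain ⟨b, hb, hyb⟩ := hy
  obtain ⟨k, hk, hmk⟩ := exists_smul_eq_of_dotProduct_eq_zero hxy hxy hm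
    (by rw [dotProduct_comm, dot_self_cross]) (by rw [dotProduct_comm, dot_cross_self]) hmx hmy
  have h := hr.dotProduct_cross x y z hxy hz (by
    rw [hmk, dotProduct_smul, smul_eq_mul] at hzm
    exact (mul_eq_zero.1 hzm).resolve_left hk)
  rw [hxa, hyb] at h
  simp only [map_smul, LinearMap.smul_apply, dotProduct_smul, smul_eq_mul, mul_eq_zero, ha, hb,
    false_or] at h
  rw [hmk, dotProduct_smul, h, smul_zero]

theorem IsFixedLine.meet (hr : IsLineation r) {m n : Fin 3 → ℝ} (z : Fin 3 → ℝ)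
    (hm : IsFixedLine r m) (hn : IsFixedLine r n) (hmn : m ⨯₃ n ≠ 0) (hz : z ≠ 0)
    (hzm : z ⬝ᵥ m = 0) (hzn : z ⬝ᵥ n = 0) : IsFixedVec r z :=
  exists_smul_eq_of_dotProduct_eq_zero hmn hz (hr.ne_zero z hz) hzm hzn
    (hm z hz hzm) (hn z hz hzn)

/-- A map fixes the four points of the standard projective frame. -/
structure FixesFrame (r : (Fin 3 → ℝ) → Fin 3 → ℝ) : Prop where
  x_dir : IsFixedVec r ![1, 0, 0]
  y_dir : IsFixedVec r ![0, 1, 0]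
  origin : IsFixedVec r ![0, 0, 1]
  unit : IsFixedVec r ![1, 1, 1]

theorem vec_ne_zero_iff {a b c : ℝ} : ![a, b, c] ≠ 0 ↔ a ≠ 0 ∨ b ≠ 0 ∨ c ≠ 0 := by
  simp only [ne_eq, Matrix.cons_eq_zero_iff]
  simp [Matrix.zero_empty]
  tauto

theorem IsFixedVec.joinVec (hr : IsLineation r) {x₀ x₁ x₂ y₀ y₁ y₂ : ℝ} (m₀ m₁ m₂ : ℝ)
    (hx : IsFixedVec r ![x₀, x₁, x₂]) (hy : IsFixedVec r ![y₀, y₁, y₂])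
    (hxy : x₁ * y₂ - x₂ * y₁ ≠ 0 ∨ x₂ * y₀ - x₀ * y₂ ≠ 0 ∨ x₀ * y₁ - x₁ * y₀ ≠ 0)
    (hm : m₀ ≠ 0 ∨ m₁ ≠ 0 ∨ m₂ ≠ 0) (hmx : m₀ * x₀ + m₁ * x₁ + m₂ * x₂ = 0)
    (hmy : m₀ * y₀ + m₁ * y₁ + m₂ * y₂ = 0) : IsFixedLine r ![m₀, m₁, m₂] :=
  hx.join hr _ hy (by rw [cross_apply]; exact vec_ne_zero_iff.2 hxy) (vec_ne_zero_iff.2 hm)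
    (by simpa [Matrix.vec3_dotProduct, add_assoc] using hmx) (by simpa [Matrix.vec3_dotProduct, add_assoc] using hmy)

theorem IsFixedLine.meetVec (hr : IsLineation r) {x₀ x₁ x₂ y₀ y₁ y₂ : ℝ} (m₀ m₁ m₂ : ℝ)
    (hx : IsFixedLine r ![x₀, x₁, x₂]) (hy : IsFixedLine r ![y₀, y₁, y₂])
    (hxy : x₁ * y₂ - x₂ * y₁ ≠ 0 ∨ x₂ * y₀ - x₀ * y₂ ≠ 0 ∨ x₀ * y₁ - x₁ * y₀ ≠ 0)
    (hm : m₀ ≠ 0 ∨ m₁ ≠ 0 ∨ m₂ ≠ 0) (hmx : m₀ * x₀ + m₁ * x₁ + m₂ * x₂ = 0)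
    (hmy : m₀ * y₀ + m₁ * y₁ + m₂ * y₂ = 0) : IsFixedVec r ![m₀, m₁, m₂] :=
  hx.meet hr _ hy (by rw [cross_apply]; exact vec_ne_zero_iff.2 hxy) (vec_ne_zero_iff.2 hm)
    (by simpa [Matrix.vec3_dotProduct, add_assoc] using hmx) (by simpa [Matrix.vec3_dotProduct, add_assoc] using hmy)

/-- The real numbers `a` for which the point with affine coordinates `(a, 0)` is fixed. -/
def fixedAxis (r : (Fin 3 → ℝ) → Fin 3 → ℝ) : Set ℝ := {a | IsFixedVec r ![a, 0, 1]}

namespace FixesFrame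

theorem xAxis (hr : IsLineation r) (hf : FixesFrame r) : IsFixedLine r ![0, 1, 0] :=
  hf.x_dir.joinVec hr _ _ _ hf.origin (by simp) (by simp) (by simp) (by simp)

theorem yAxis (hr : IsLineation r) (hf : FixesFrame r) : IsFixedLine r ![1, 0, 0] :=
  hf.y_dir.joinVec hr _ _ _ hf.origin (by simp) (by simp) (by simp) (by simp)

theorem infinity (hr : IsLineation r) (hf : FixesFrame r) : IsFixedLine r ![0, 0, 1] :=
  hf.x_dir.joinVec hr _ _ _ hf.y_dir (by simp) (by simp) (by simp) (by simp)

theorem diagonal (hr : IsLineation r) (hf : FixesFrame r) : IsFixedLine r ![1, -1, 0] :=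
  hf.origin.joinVec hr _ _ _ hf.unit (by simp) (by simp) (by simp) (by simp)

theorem vertical (hr : IsLineation r) (hf : FixesFrame r) {a : ℝ} (ha : a ∈ fixedAxis r) :
    IsFixedLine r ![1, 0, -a] :=
  hf.y_dir.joinVec hr _ _ _ ha (by simp) (by simp) (by simp) (by simp)

theorem horizontal (hr : IsLineation r) (hf : FixesFrame r) {a : ℝ} (ha : a ∈ fixedAxis r) :
    IsFixedLine r ![0, 1, -a] :=
  hf.x_dir.joinVec hr _ _ _ (((hf.vertical hr ha).meetVec hr a a 1 (hf.diagonal hr)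
    (by simp) (by simp) (by simp) (by simp))) (by simp) (by simp) (by simp) (by simp)

theorem point (hr : IsLineation r) (hf : FixesFrame r) {a b : ℝ} (ha : a ∈ fixedAxis r)
    (hb : b ∈ fixedAxis r) : IsFixedVec r ![a, b, 1] :=
  (hf.vertical hr ha).meetVec hr _ _ _ (hf.horizontal hr hb) (by simp) (by simp) (by simp)
    (by simp)

theorem mem_of_point (hr : IsLineation r) (hf : FixesFrame r) {a b : ℝ}
    (h : IsFixedVec r ![a, b, 1]) : a ∈ fixedAxis r :=
  (h.joinVec hr 1 0 (-a) hf.y_dir (by simp) (by simp) (by simp) (by simp)).meetVec hr _ _ _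
    (hf.xAxis hr) (by simp) (by simp) (by simp) (by simp)

theorem zero_mem (hf : FixesFrame r) : 0 ∈ fixedAxis r := hf.origin

theorem one_mem (hr : IsLineation r) (hf : FixesFrame r) : 1 ∈ fixedAxis r :=
  hf.mem_of_point hr hf.unit

theorem antidiagonal_direction (hr : IsLineation r) (hf : FixesFrame r) :
    IsFixedVec r ![1, -1, 0] :=
  ((hf.point hr (hf.one_mem hr) hf.zero_mem).joinVec hr 1 1 (-1)
    (hf.point hr hf.zero_mem (hf.one_mem hr)) (by simp) (by simp) (by simp) (by simp)).meetVec hr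
    _ _ _ (hf.infinity hr) (by simp) (by simp) (by simp) (by simp)

theorem sub_mem (hr : IsLineation r) (hf : FixesFrame r) {a b : ℝ} (ha : a ∈ fixedAxis r)
    (hb : b ∈ fixedAxis r) : a - b ∈ fixedAxis r :=
  hf.mem_of_point hr (b := b) <|
    (IsFixedVec.joinVec hr 1 1 (-a) ha (hf.antidiagonal_direction hr) (by simp) (by simp)
      (by simp) (by simp)).meetVec hr _ _ _ (hf.horizontal hr hb) (by simp) (by simp)
      (by ring) (by ring)

theorem line_through_origin (hr : IsLineation r) (hf : FixesFrame r) {a : ℝ}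
    (ha : a ∈ fixedAxis r) : IsFixedLine r ![a, -1, 0] :=
  hf.origin.joinVec hr _ _ _ (hf.point hr (hf.one_mem hr) ha) (by simp) (by simp) (by simp)
    (by simp)

theorem mul_mem (hr : IsLineation r) (hf : FixesFrame r) {a b : ℝ} (ha : a ∈ fixedAxis r)
    (hb : b ∈ fixedAxis r) : a * b ∈ fixedAxis r := by
  have h : IsFixedVec r ![b, a * b, 1] :=
    (hf.line_through_origin hr ha).meetVec hr _ _ _ (hf.vertical hr hb) (by simp) (by simp)
      (by ring) (by ring)
  have h' := h.joinVec hr 0 1 (-(a * b)) hf.x_dir (by simp) (by simp) (by ring) (by ring)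
  have h'' := h'.meetVec hr (a * b) (a * b) 1 (hf.diagonal hr) (by simp) (by simp) (by ring)
    (by ring)
  exact hf.mem_of_point hr h''

theorem inv_mem (hr : IsLineation r) (hf : FixesFrame r) {a : ℝ} (ha : a ∈ fixedAxis r) :
    a⁻¹ ∈ fixedAxis r := by
  rcases eq_or_ne a 0 with rfl | h0
  · simpa using hf.zero_mem
  · exact hf.mem_of_point hr (b := 1) <| (hf.line_through_origin hr ha).meetVec hr _ _ _
      (hf.horizontal hr (hf.one_mem hr)) (by simp) (by simp) (by simp [h0]) (by simp)

/-- The fixed points of the first axis form a subfield. -/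
def subfield (hr : IsLineation r) (hf : FixesFrame r) : Subfield ℝ where
  carrier := fixedAxis r
  zero_mem' := hf.zero_mem
  one_mem' := hf.one_mem hr
  add_mem' {a b} ha hb := by
    simpa using hf.sub_mem hr ha (hf.sub_mem hr hf.zero_mem hb)
  neg_mem' {a} ha := by simpa using hf.sub_mem hr hf.zero_mem ha
  mul_mem' := hf.mul_mem hr
  inv_mem' _ := hf.inv_mem hr

theorem fixedAxis_eq_univ (hr : IsLineation r) (hf : FixesFrame r)
    (hc : IsClosed (fixedAxis r)) : fixedAxis r = Set.univ := by
  refine Set.eq_univ_of_univ_subset ?_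
  rw [← Rat.denseRange_cast (𝕜 := ℝ) |>.closure_range]
  refine closure_minimal ?_ hc
  rintro _ ⟨q, rfl⟩
  exact SubfieldClass.ratCast_mem (hf.subfield hr) q

/-- A lineation of the real projective plane fixing the standard frame is the identity as soon
as its fixed points on one axis form a closed set. -/
theorem isFixedVec (hr : IsLineation r) (hf : FixesFrame r) (hc : IsClosed (fixedAxis r))
    (x : Fin 3 → ℝ) (hx : x ≠ 0) : IsFixedVec r x := by
  have hall : ∀ a, a ∈ fixedAxis r := by simp [hf.fixedAxis_eq_univ hr hc]
  obtain ⟨a, b, c, rfl⟩ : ∃ a b c, x = ![a, b, c] :=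
    ⟨x 0, x 1, x 2, by ext i; fin_cases i <;> rfl⟩
  by_cases h0 : c = 0
  · subst h0
    have hab : a ≠ 0 ∨ b ≠ 0 := by simpa using vec_ne_zero_iff.1 hx
    have h := hf.origin.joinVec hr b (-a) 0 (hf.point hr (hall a) (hall b)) (by simp; tauto)
      (by simp; tauto) (by ring) (by ring)
    exact h.meetVec hr _ _ _ (hf.infinity hr) (by simp; tauto) (by simp; tauto) (by ring)
      (by ring)
  · exact (hf.vertical hr (hall (a / c))).meetVec hr _ _ _ (hf.horizontal hr (hall (b / c)))
      (by simp) (by simp [h0]) (by field_simp; ring) (by field_simp; ring)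

end FixesFrame

end FixedVectors

section Topology

open scoped Matrix

theorem continuous_projectivization_mk' (V : Type*) [AddCommGroup V] [Module ℝ V]
    [TopologicalSpace V] : Continuous (Projectivization.mk' ℝ : {v : V // v ≠ 0} → ℙ ℝ V) :=
  continuous_coinduced_rng

/-- The squared sine of the angle between a vector and a line, up to the norm of the vector. -/
noncomputable def crossSq (w : Fin 3 → ℝ) : ℙ ℝ (Fin 3 → ℝ) → ℝ :=
  Projectivization.lift (fun u => ((w ⨯₃ u.1) ⬝ᵥ (w ⨯₃ u.1)) / (u.1 ⬝ᵥ u.1)) (by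
    rintro ⟨a, ha⟩ ⟨b, hb⟩ t (rfl : a = t • b)
    have ht : t ≠ 0 := by rintro rfl; simp at ha
    simp only [map_smul, smul_dotProduct, dotProduct_smul, smul_eq_mul, ← mul_assoc]
    exact mul_div_mul_left _ _ (mul_ne_zero ht ht))

theorem continuous_crossSq (w : Fin 3 → ℝ) : Continuous (crossSq w) := by
  refine continuous_coinduced_dom.2 ?_
  change Continuous fun u : {v : Fin 3 → ℝ // v ≠ 0} =>
    ((w ⨯₃ u.1) ⬝ᵥ (w ⨯₃ u.1)) / (u.1 ⬝ᵥ u.1)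
  have hnum : Continuous fun v : Fin 3 → ℝ => (w ⨯₃ v) ⬝ᵥ (w ⨯₃ v) := by
    simp only [cross_apply, Matrix.vec3_dotProduct]
    simp
    fun_prop
  have hden : Continuous fun v : Fin 3 → ℝ => v ⬝ᵥ v := by
    simp only [Matrix.vec3_dotProduct]
    fun_prop
  exact (hnum.comp continuous_subtype_val).div (hden.comp continuous_subtype_val)
    fun u => by simpa using u.2

theorem crossSq_eq_zero_iff (p q : ℙ ℝ (Fin 3 → ℝ)) : crossSq p.rep q = 0 ↔ p = q := by
  induction q using Projectivization.ind with | h u hu =>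
  have hu' : u ⬝ᵥ u ≠ 0 := by simpa using hu
  have : crossSq p.rep (mk ℝ u hu) =
      ((p.rep ⨯₃ u) ⬝ᵥ (p.rep ⨯₃ u)) / (u ⬝ᵥ u) := rfl
  rw [this, div_eq_zero_iff, or_iff_left hu', dotProduct_self_eq_zero]
  constructor
  · intro h
    obtain ⟨k, hk, hku⟩ := exists_smul_eq_of_cross_eq_zero p.rep_nonzero hu h
    rw [eq_comm, ← p.mk_rep, mk_eq_mk_iff']
    exact ⟨k, hku.symm⟩
  · rintro rfl
    obtain ⟨a, ha⟩ := exists_smul_eq_mk_rep ℝ u hu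
    rw [← ha, Units.smul_def]
    simp

theorem t2Space_projectivePlane : T2Space (ℙ ℝ (Fin 3 → ℝ)) where
  t2 p q hpq := separated_by_continuous (continuous_crossSq p.rep) (by
    rw [(crossSq_eq_zero_iff p p).2 rfl]
    exact fun h => hpq ((crossSq_eq_zero_iff p q).1 h.symm))

end Topology

section Frames

variable {V : Type*} [AddCommGroup V] [Module ℝ V]

/-- Four points of a projective plane, no three of which are collinear, have representatives
`v 0`, `v 1`, `v 2` and `v 0 + v 1 + v 2`. -/
theorem exists_frame [FiniteDimensional ℝ V] (P : Fin 4 → ℙ ℝ V) (W : Submodule ℝ V)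
    (hW : Module.finrank ℝ W = 3) (hP : ∀ i, (P i).rep ∈ W)
    (hcol : ∀ i j k : Fin 4, i ≠ j → j ≠ k → i ≠ k → ¬ ProjCollinear {P i, P j, P k}) :
    ∃ v : Fin 3 → V, LinearIndependent ℝ v ∧ Submodule.span ℝ (Set.range v) = W ∧
      (∀ i, ∃ h : v i ≠ 0, P i.castSucc = mk ℝ (v i) h) ∧
      ∃ h : ∑ i, v i ≠ 0, P 3 = mk ℝ (∑ i, v i) h := by
  set u : Fin 3 → V := fun i => (P i.castSucc).rep
  have hli : LinearIndependent ℝ u := by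
    rw [linearIndependent_iff_card_le_finrank_span]
    by_contra hlt
    refine hcol 0 1 2 (by decide) (by decide) (by decide)
      ⟨Submodule.span ℝ (Set.range u), ?_, ?_⟩
    · have : Module.finrank ℝ (Submodule.span ℝ (Set.range u)) < 3 := by
        simpa [Set.finrank] using hlt
      omega
    · rintro p (rfl | rfl | rfl)
      exacts [Submodule.subset_span ⟨0, rfl⟩, Submodule.subset_span ⟨1, rfl⟩,
        Submodule.subset_span ⟨2, rfl⟩]
  have hspan : ∀ v : Fin 3 → V, LinearIndependent ℝ v → (∀ i, v i ∈ W) →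
      Submodule.span ℝ (Set.range v) = W := fun v hv hvW =>
    Submodule.eq_of_le_of_finrank_eq (Submodule.span_le.2 (by rintro _ ⟨i, rfl⟩; exact hvW i))
      (by rw [finrank_span_eq_card hv, hW]; rfl)
  have h3 : (P 3).rep ∈ Submodule.span ℝ (Set.range u) := by
    rw [hspan u hli fun i => hP _]
    exact hP 3
  obtain ⟨a, ha⟩ := (Submodule.mem_span_range_iff_exists_fun ℝ).1 h3
  have ha0 : ∀ i, a i ≠ 0 := by
    have key : ∀ i j k : Fin 3, i ≠ j → j ≠ k → i ≠ k → a i ≠ 0 := by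
      intro i j k hij hjk hik h0
      have hsum : (P 3).rep = a j • u j + a k • u k := by
        rw [← ha]
        have huniv : (Finset.univ : Finset (Fin 3)) = {i, j, k} := by
          clear h0
          revert i j k
          decide
        rw [huniv, Finset.sum_insert (by simp [hij, hik]), Finset.sum_pair hjk, h0, zero_smul,
          zero_add]
      refine hcol j.castSucc k.castSucc 3 (by simpa using hjk) (Fin.castSucc_lt_last k).ne
        (Fin.castSucc_lt_last j).ne ⟨Submodule.span ℝ (Set.range ![u j, u k]), ?_, ?_⟩
      · exact finrank_range_le_card (R := ℝ) ![u j, u k]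
      · have hj : u j ∈ Submodule.span ℝ (Set.range ![u j, u k]) :=
          Submodule.subset_span ⟨0, rfl⟩
        have hk : u k ∈ Submodule.span ℝ (Set.range ![u j, u k]) :=
          Submodule.subset_span ⟨1, rfl⟩
        rintro p (rfl | rfl | rfl)
        · exact hj
        · exact hk
        · rw [hsum]
          exact add_mem (Submodule.smul_mem _ _ hj) (Submodule.smul_mem _ _ hk)
    intro i
    exact key i (i + 1) (i + 2) (by revert i; decide) (by revert i; decide)
      (by revert i; decide)
  have hv : LinearIndependent ℝ fun i => a i • u i :=
    hli.units_smul fun i => Units.mk0 (a i) (ha0 i)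
  refine ⟨fun i => a i • u i, hv, hspan _ hv fun i => W.smul_mem _ (hP _),
    fun i => ⟨hv.ne_zero i, ?_⟩, ?_⟩
  · rw [← mk_rep (P i.castSucc), eq_comm, mk_eq_mk_iff']
    exact ⟨a i, rfl⟩
  · simp only [ha]
    exact ⟨rep_nonzero _, (mk_rep _).symm⟩

end Frames

section Cameras

open scoped Matrix

theorem rep_mem_iff {V : Type*} [AddCommGroup V] [Module ℝ V] (p : ℙ ℝ V) {v : V} (hv : v ≠ 0)
    (W : Submodule ℝ V) (h : p = mk ℝ v hv) : p.rep ∈ W ↔ v ∈ W := by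
  obtain ⟨a, ha⟩ := exists_smul_eq_mk_rep ℝ v hv
  rw [h, ← ha, Units.smul_def]
  exact W.smul_mem_iff a.ne_zero

theorem dotProduct_cross_eq_zero_of_finrank_le {W : Submodule ℝ (Fin 3 → ℝ)}
    (hW : Module.finrank ℝ W ≤ 2) {x y z : Fin 3 → ℝ} (hx : x ∈ W) (hy : y ∈ W) (hz : z ∈ W) :
    z ⬝ᵥ (x ⨯₃ y) = 0 := by
  by_contra h
  rw [triple_product_eq_det] at h
  have hli : LinearIndependent ℝ ![z, x, y] := by
    have := Matrix.linearIndependent_rows_iff_isUnit.2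
      ((Matrix.isUnit_iff_isUnit_det (Matrix.of ![z, x, y])).2 (isUnit_iff_ne_zero.2 h))
    exact this
  have h3 := finrank_span_eq_card hli
  have hle : Submodule.span ℝ (Set.range ![z, x, y]) ≤ W := Submodule.span_le.2 (by
    rintro _ ⟨i, rfl⟩
    fin_cases i
    exacts [hz, hx, hy])
  have := Submodule.finrank_mono hle
  rw [h3, Fintype.card_fin] at this
  omega

variable {C : ℙ ℝ (Fin 4 → ℝ)} {A : (Fin 3 → ℝ) →ₗ[ℝ] (Fin 4 → ℝ)}

theorem mk_apply_ne (hAC : C.rep ∉ LinearMap.range A)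
    {x : Fin 3 → ℝ} (h : A x ≠ 0) : mk ℝ (A x) h ≠ C := by
  intro hC
  exact hAC ((rep_mem_iff C h _ hC.symm).2 ⟨x, rfl⟩)

/-- The point of `ℙ³` different from `C` with coordinates `x` in a plane avoiding `C`. -/
noncomputable def planePoint (hA : Function.Injective A) (hAC : C.rep ∉ LinearMap.range A)
    (x : {x : Fin 3 → ℝ // x ≠ 0}) : {p : ℙ ℝ (Fin 4 → ℝ) // p ≠ C} :=
  ⟨mk ℝ (A x) ((map_ne_zero_iff A hA).2 x.2), mk_apply_ne hAC _⟩

theorem continuous_planePoint (hA : Function.Injective A) (hAC : C.rep ∉ LinearMap.range A) :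
    Continuous (planePoint hA hAC) := by
  refine Continuous.subtype_mk ?_ _
  exact (continuous_projectivization_mk' (Fin 4 → ℝ)).comp
    (((LinearMap.continuous_of_finiteDimensional A).comp continuous_subtype_val).subtype_mk
      fun x => (map_ne_zero_iff A hA).2 x.2)

variable {T : {p : ℙ ℝ (Fin 4 → ℝ) // p ≠ C} → ℙ ℝ (Fin 3 → ℝ)}

open Classical in
/-- The restriction of `T` to a plane, on coordinate vectors of the source and the target. -/
noncomputable def imageVec (T : {p : ℙ ℝ (Fin 4 → ℝ) // p ≠ C} → ℙ ℝ (Fin 3 → ℝ))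
    (hA : Function.Injective A) (hAC : C.rep ∉ LinearMap.range A)
    (B : (Fin 3 → ℝ) ≃ₗ[ℝ] (Fin 3 → ℝ)) (x : Fin 3 → ℝ) : Fin 3 → ℝ :=
  if h : x ≠ 0 then B.symm (T (planePoint hA hAC ⟨x, h⟩)).rep else 0

theorem imageVec_of_ne_zero (hA : Function.Injective A) (hAC : C.rep ∉ LinearMap.range A)
    (B : (Fin 3 → ℝ) ≃ₗ[ℝ] (Fin 3 → ℝ)) {x : Fin 3 → ℝ} (h : x ≠ 0) :
    imageVec T hA hAC B x = B.symm (T (planePoint hA hAC ⟨x, h⟩)).rep :=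
  dif_pos h

theorem isFixedVec_imageVec_iff (hA : Function.Injective A) (hAC : C.rep ∉ LinearMap.range A)
    (B : (Fin 3 → ℝ) ≃ₗ[ℝ] (Fin 3 → ℝ)) {x : Fin 3 → ℝ} (h : x ≠ 0) :
    IsFixedVec (imageVec T hA hAC B) x ↔
      T (planePoint hA hAC ⟨x, h⟩) = mk ℝ (B x) (B.map_ne_zero_iff.2 h) := by
  rw [IsFixedVec, imageVec_of_ne_zero hA hAC B h]
  set p := T (planePoint hA hAC ⟨x, h⟩)
  constructor
  · rintro ⟨k, hk, hkx⟩
    rw [LinearEquiv.symm_apply_eq, map_smul] at hkx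
    rw [← mk_rep p, mk_eq_mk_iff']
    exact ⟨k, hkx.symm⟩
  · intro hp
    obtain ⟨a, ha⟩ := exists_smul_eq_mk_rep ℝ (B x) (B.map_ne_zero_iff.2 h)
    exact ⟨a, a.ne_zero, by rw [hp, ← ha, Units.smul_def, map_smul, B.symm_apply_apply]⟩

theorem isLineation_imageVec (hA : Function.Injective A) (hAC : C.rep ∉ LinearMap.range A)
    (B : (Fin 3 → ℝ) ≃ₗ[ℝ] (Fin 3 → ℝ))
    (ha : ∀ (p q r : {p : ℙ ℝ (Fin 4 → ℝ) // p ≠ C}),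
      (∃ W : Submodule ℝ (Fin 4 → ℝ), Module.finrank ℝ W = 2 ∧ C.rep ∉ W ∧
        p.1.rep ∈ W ∧ q.1.rep ∈ W ∧ r.1.rep ∈ W) →
      ProjCollinear {T p, T q, T r}) :
    IsLineation (imageVec T hA hAC B) where
  ne_zero z hz := by
    rw [imageVec_of_ne_zero hA hAC B hz]
    exact B.symm.map_ne_zero_iff.2 (rep_nonzero _)
  dotProduct_cross x y z hxy hz hzm := by
    have hx : x ≠ 0 := by rintro rfl; simp at hxy
    have hy : y ≠ 0 := by rintro rfl; simp at hxy
    let φ : (Fin 3 → ℝ) →ₗ[ℝ] ℝ := Fintype.linearCombination ℝ (x ⨯₃ y)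
    have hφ : φ ≠ 0 := fun h0 => hxy (dotProduct_self_eq_zero.1 (LinearMap.congr_fun h0 _))
    have hmem : ∀ u (hu : u ≠ 0), u ⬝ᵥ (x ⨯₃ y) = 0 →
        (planePoint hA hAC ⟨u, hu⟩).1.rep ∈ (LinearMap.ker φ).map A := fun u hu h0 =>
      (rep_mem_iff _ _ _ rfl).2 ⟨u, h0, rfl⟩
    obtain ⟨W', hW', hrep⟩ := ha (planePoint hA hAC ⟨x, hx⟩) (planePoint hA hAC ⟨y, hy⟩)
      (planePoint hA hAC ⟨z, hz⟩) ⟨(LinearMap.ker φ).map A, by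
        have h1 := Module.Dual.finrank_ker_add_one_of_ne_zero hφ
        rw [Module.finrank_fin_fun] at h1
        rw [(Submodule.equivMapOfInjective A hA _).symm.finrank_eq]
        exact Nat.succ.inj h1, fun hC => hAC (LinearMap.map_le_range hC),
        hmem x hx (dot_self_cross x y), hmem y hy (dot_cross_self x y), hmem z hz hzm⟩
    refine dotProduct_cross_eq_zero_of_finrank_le
      (W := W'.map (B.symm : (Fin 3 → ℝ) →ₗ[ℝ] (Fin 3 → ℝ)))
      (by rwa [LinearEquiv.finrank_map_eq]) ?_ ?_ ?_
    all_goals rw [imageVec_of_ne_zero hA hAC B (by assumption)]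
    all_goals exact Submodule.mem_map_of_mem (hrep _ (by simp))

theorem isClosed_fixedAxis_imageVec (hT : Continuous T) (hA : Function.Injective A)
    (hAC : C.rep ∉ LinearMap.range A) (B : (Fin 3 → ℝ) ≃ₗ[ℝ] (Fin 3 → ℝ)) :
    IsClosed (fixedAxis (imageVec T hA hAC B)) := by
  have := t2Space_projectivePlane
  let u : ℝ → {x : Fin 3 → ℝ // x ≠ 0} := fun a => ⟨![a, 0, 1], vec_ne_zero_iff.2 (by simp)⟩
  have hu : Continuous u := Continuous.subtype_mk (by fun_prop) _
  have hB : Continuous fun x : {x : Fin 3 → ℝ // x ≠ 0} =>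
      mk ℝ (B x) (B.map_ne_zero_iff.2 x.2) :=
    (continuous_projectivization_mk' (Fin 3 → ℝ)).comp
      (((LinearMap.continuous_of_finiteDimensional B.toLinearMap).comp
        continuous_subtype_val).subtype_mk fun x => B.map_ne_zero_iff.2 x.2)
  have hset : fixedAxis (imageVec T hA hAC B) =
      {a | T (planePoint hA hAC (u a)) = mk ℝ (B (u a)) (B.map_ne_zero_iff.2 (u a).2)} := by
    ext a
    exact isFixedVec_imageVec_iff hA hAC B (u a).2
  rw [hset]
  exact isClosed_eq (hT.comp ((continuous_planePoint hA hAC).comp hu)) (hB.comp hu)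

theorem isFixedVec_of_eq_mk (hA : Function.Injective A) (hAC : C.rep ∉ LinearMap.range A)
    (B : (Fin 3 → ℝ) ≃ₗ[ℝ] (Fin 3 → ℝ)) {x : Fin 3 → ℝ} (hx : x ≠ 0)
    (p : {p : ℙ ℝ (Fin 4 → ℝ) // p ≠ C}) {v : Fin 4 → ℝ} {w : Fin 3 → ℝ}
    (hp : ∃ h, p.1 = mk ℝ v h) (hTp : ∃ h, T p = mk ℝ w h) (hv : A x = v) (hw : B x = w) :
    IsFixedVec (imageVec T hA hAC B) x := by
  subst hv hw
  obtain ⟨h, hp⟩ := hp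
  obtain ⟨h', hTp⟩ := hTp
  rw [isFixedVec_imageVec_iff hA hAC B hx, ← hTp]
  exact congrArg T (Subtype.ext hp.symm)

end Cameras

theorem pinhole_characterization
    (C : ℙ ℝ (Fin 4 → ℝ))
    (T : {p : ℙ ℝ (Fin 4 → ℝ) // p ≠ C} → ℙ ℝ (Fin 3 → ℝ))
    (hT : Continuous T)
    -- (a) three points on a projective line not containing C have collinear images
    (ha : ∀ (p q r : {p : ℙ ℝ (Fin 4 → ℝ) // p ≠ C}),
      (∃ W : Submodule ℝ (Fin 4 → ℝ), Module.finrank ℝ W = 2 ∧ C.rep ∉ W ∧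
        p.1.rep ∈ W ∧ q.1.rep ∈ W ∧ r.1.rep ∈ W) →
      ProjCollinear {T p, T q, T r})
    -- (b) two points on a projective line containing C have the same image
    (hb : ∀ (p q : {p : ℙ ℝ (Fin 4 → ℝ) // p ≠ C}),
      (∃ W : Submodule ℝ (Fin 4 → ℝ), Module.finrank ℝ W = 2 ∧ C.rep ∈ W ∧
        p.1.rep ∈ W ∧ q.1.rep ∈ W) →
      T p = T q)
    -- (c) four points on a projective plane not containing C, no three of them collinear,
    -- whose images have no three collinear
    (hc : ∃ (P : Fin 4 → {p : ℙ ℝ (Fin 4 → ℝ) // p ≠ C}),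
      (∃ W : Submodule ℝ (Fin 4 → ℝ), Module.finrank ℝ W = 3 ∧ C.rep ∉ W ∧
        ∀ i, (P i).1.rep ∈ W) ∧
      (∀ i j k : Fin 4, i ≠ j → j ≠ k → i ≠ k →
        ¬ ProjCollinear {(P i).1, (P j).1, (P k).1}) ∧
      (∀ i j k : Fin 4, i ≠ j → j ≠ k → i ≠ k →
        ¬ ProjCollinear {T (P i), T (P j), T (P k)})) :
    -- conclusion: T is a pinhole camera with center C
    ∃ L : (Fin 4 → ℝ) →ₗ[ℝ] (Fin 3 → ℝ),
      Function.Surjective L ∧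
      LinearMap.ker L = Submodule.span ℝ {C.rep} ∧
      ∀ (v : Fin 4 → ℝ) (hv : v ≠ 0) (h : Projectivization.mk ℝ v hv ≠ C),
        ∃ h0 : L v ≠ 0, T ⟨Projectivization.mk ℝ v hv, h⟩ = Projectivization.mk ℝ (L v) h0 := by
  obtain ⟨P, ⟨W, hW, hCW, hP⟩, hcol, hcol'⟩ := hc
  obtain ⟨v, hv, hvW, hvP, hvP3⟩ := exists_frame (fun i => (P i).1) W hW hP hcol
  obtain ⟨w, hw, -, hwP, hwP3⟩ := exists_frame (fun i => T (P i)) ⊤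
    (by rw [finrank_top, Module.finrank_fin_fun]) (fun _ => Submodule.mem_top) hcol'
  let A : (Fin 3 → ℝ) →ₗ[ℝ] (Fin 4 → ℝ) := Fintype.linearCombination ℝ v
  have hA : Function.Injective A := hv.fintypeLinearCombination_injective
  have hAC : C.rep ∉ LinearMap.range A := by
    rwa [Fintype.range_linearCombination, hvW]
  let B : (Fin 3 → ℝ) ≃ₗ[ℝ] (Fin 3 → ℝ) :=
    LinearEquiv.ofInjectiveEndo (Fintype.linearCombination ℝ w)
      hw.fintypeLinearCombination_injective
  have hAx : ∀ a b c : ℝ, A ![a, b, c] = a • v 0 + b • v 1 + c • v 2 := fun a b c => by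
    simp [A, Fintype.linearCombination_apply, Fin.sum_univ_three]
  have hBx : ∀ a b c : ℝ, B ![a, b, c] = a • w 0 + b • w 1 + c • w 2 := fun a b c => by
    simp [B, Fintype.linearCombination_apply, Fin.sum_univ_three]
  have hframe : FixesFrame (imageVec T hA hAC B) :=
    { x_dir := isFixedVec_of_eq_mk hA hAC B (vec_ne_zero_iff.2 (by simp)) (P 0) (hvP 0) (hwP 0)
        (by simp [hAx]) (by simp [hBx])
      y_dir := isFixedVec_of_eq_mk hA hAC B (vec_ne_zero_iff.2 (by simp)) (P 1) (hvP 1) (hwP 1)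
        (by simp [hAx]) (by simp [hBx])
      origin := isFixedVec_of_eq_mk hA hAC B (vec_ne_zero_iff.2 (by simp)) (P 2) (hvP 2) (hwP 2)
        (by simp [hAx]) (by simp [hBx])
      unit := isFixedVec_of_eq_mk hA hAC B (vec_ne_zero_iff.2 (by simp)) (P 3) hvP3 hwP3
        (by simp [hAx, Fin.sum_univ_three]) (by simp [hBx, Fin.sum_univ_three]) }
  have hplane : ∀ x (hx : x ≠ 0), T (planePoint hA hAC ⟨x, hx⟩) =
      mk ℝ (B x) (B.map_ne_zero_iff.2 hx) := fun x hx =>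
    (isFixedVec_imageVec_iff hA hAC B hx).1 <| hframe.isFixedVec
      (isLineation_imageVec hA hAC B ha) (isClosed_fixedAxis_imageVec hT hA hAC B) x hx
  let S : ((Fin 3 → ℝ) × ℝ) →ₗ[ℝ] (Fin 4 → ℝ) :=
    A.coprod (LinearMap.toSpanSingleton ℝ (Fin 4 → ℝ) C.rep)
  have hSx : ∀ x t, S (x, t) = A x + t • C.rep := fun x t => by simp [S]
  have hS : Function.Injective S := by
    rw [injective_iff_map_eq_zero]
    rintro ⟨x, t⟩ h
    rw [hSx] at h
    have ht : t = 0 := by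
      by_contra ht
      refine hAC ⟨-t⁻¹ • x, ?_⟩
      rw [map_smul, eq_neg_of_add_eq_zero_left h, smul_neg, neg_smul, neg_neg, smul_smul,
        inv_mul_cancel₀ ht, one_smul]
    subst ht
    rw [zero_smul, add_zero] at h
    rw [(map_eq_zero_iff A hA).1 h, Prod.mk_zero_zero]
  let E : ((Fin 3 → ℝ) × ℝ) ≃ₗ[ℝ] (Fin 4 → ℝ) := LinearMap.linearEquivOfInjective S hS (by simp)
  have hEx : ∀ x t, E (x, t) = A x + t • C.rep := hSx
  let L : (Fin 4 → ℝ) →ₗ[ℝ] (Fin 3 → ℝ) :=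
    B.toLinearMap ∘ₗ LinearMap.fst ℝ _ _ ∘ₗ E.symm.toLinearMap
  have hLE : ∀ (x : Fin 3 → ℝ) (t : ℝ), L (A x + t • C.rep) = B x := fun x t => by
    rw [← hEx]
    simp [L]
  have hdecomp : ∀ u, ∃ (x : Fin 3 → ℝ) (t : ℝ), A x + t • C.rep = u := fun u =>
    ⟨(E.symm u).1, (E.symm u).2, by rw [← hEx, Prod.mk.eta, E.apply_symm_apply]⟩
  refine ⟨L, fun y => ⟨A (B.symm y) + (0 : ℝ) • C.rep, ?_⟩, ?_, ?_⟩
  · rw [hLE, B.apply_symm_apply]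
  · ext u
    obtain ⟨x, t, rfl⟩ := hdecomp u
    rw [LinearMap.mem_ker, hLE, B.map_eq_zero_iff, Submodule.mem_span_singleton]
    constructor
    · rintro rfl
      exact ⟨t, by simp⟩
    · rintro ⟨s, hs⟩
      have h : E (0, s) = E (x, t) := by rw [hEx, hEx, ← hs, map_zero, zero_add]
      exact (congrArg Prod.fst (E.injective h)).symm
  · intro u hu hne
    obtain ⟨x, t, rfl⟩ := hdecomp u
    have hx : x ≠ 0 := by
      rintro rfl
      refine hne ?_
      conv_rhs => rw [← C.mk_rep]
      rw [mk_eq_mk_iff']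
      exact ⟨t, by simp⟩
    have h0 : L (A x + t • C.rep) ≠ 0 := by
      rw [hLE]
      exact B.map_ne_zero_iff.2 hx
    refine ⟨h0, ?_⟩
    have hli : LinearIndependent ℝ ![C.rep, A x] := by
      rw [LinearIndependent.pair_iff' C.rep_nonzero]
      intro s hs
      have h : E (0, s) = E (x, 0) := by rw [hEx, hEx, hs, map_zero, zero_add]; simp
      exact hx (congrArg Prod.fst (E.injective h)).symm
    have hC : C.rep ∈ Submodule.span ℝ (Set.range ![C.rep, A x]) :=
      Submodule.subset_span ⟨0, rfl⟩
    have hAx' : A x ∈ Submodule.span ℝ (Set.range ![C.rep, A x]) :=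
      Submodule.subset_span ⟨1, rfl⟩
    rw [hb _ (planePoint hA hAC ⟨x, hx⟩) ⟨Submodule.span ℝ (Set.range ![C.rep, A x]),
      finrank_span_eq_card hli, hC,
      (rep_mem_iff _ hu _ rfl).2 (add_mem hAx' (Submodule.smul_mem _ _ hC)),
      (rep_mem_iff _ _ _ rfl).2 hAx'⟩, hplane x hx]
    simp only [hLE]
end

section
/- Every bijection of the real projective plane P^2 onto itself that maps collinear points to collinear points (i.e., whenever three points lie on a common projective line, so do their images) is a homography: it is induced by an invertible linear map of R^3. Consequently, two distortion corrections that both map the images of all straight lines to straight lines differ by a homography of the projective plane. -/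
open scoped LinearAlgebra.Projectivization
open Projectivization

section CollinearityPreserving

open scoped Matrix

/-- A self-map of `ℝ³` that represents an injective self-map of the projective plane preserving
collinearity. Vectors are proportional if their cross product vanishes, and they represent
collinear points if their triple product vanishes. -/
structure IsCollineationLift (F : (Fin 3 → ℝ) → (Fin 3 → ℝ)) : Prop where
  ne_zero : ∀ v, v ≠ 0 → F v ≠ 0
  cross_eq_zero : ∀ u v, F u ⨯₃ F v = 0 → u ⨯₃ v = 0
  triple_eq_zero : ∀ u v w, u ⬝ᵥ v ⨯₃ w = 0 → F u ⬝ᵥ F v ⨯₃ F w = 0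

theorem triple_ne_zero_iff_linearIndependent {u v w : Fin 3 → ℝ} :
    u ⬝ᵥ v ⨯₃ w ≠ 0 ↔ LinearIndependent ℝ ![u, v, w] := by
  rw [triple_product_eq_det]
  have h := Matrix.linearIndependent_rows_iff_isUnit (A := Matrix.of ![u, v, w])
  rw [Matrix.isUnit_iff_isUnit_det, isUnit_iff_ne_zero] at h
  exact h.symm

theorem cross_map_eq_zero_iff (e : (Fin 3 → ℝ) ≃ₗ[ℝ] (Fin 3 → ℝ)) {u v : Fin 3 → ℝ} :
    e u ⨯₃ e v = 0 ↔ u ⨯₃ v = 0 := by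
  rw [← not_iff_not, ← ne_eq, ← ne_eq, crossProduct_ne_zero_iff_linearIndependent,
    crossProduct_ne_zero_iff_linearIndependent,
    ← LinearMap.linearIndependent_iff e.toLinearMap e.ker (v := ![u, v])]
  rw [show e.toLinearMap ∘ ![u, v] = ![e u, e v] from by
    ext i : 1; fin_cases i <;> rfl]

theorem triple_map_eq_zero_iff (e : (Fin 3 → ℝ) ≃ₗ[ℝ] (Fin 3 → ℝ)) {u v w : Fin 3 → ℝ} :
    e u ⬝ᵥ e v ⨯₃ e w = 0 ↔ u ⬝ᵥ v ⨯₃ w = 0 := by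
  rw [← not_iff_not, ← ne_eq, ← ne_eq, triple_ne_zero_iff_linearIndependent,
    triple_ne_zero_iff_linearIndependent,
    ← LinearMap.linearIndependent_iff e.toLinearMap e.ker (v := ![u, v, w])]
  rw [show e.toLinearMap ∘ ![u, v, w] = ![e u, e v, e w] from by
    ext i : 1; fin_cases i <;> rfl]

/-- If `x` lies in the plane of two independent vectors `a` and `b`, then every vector orthogonal
to `a` and `b` is orthogonal to `x`. -/
theorem dotProduct_eq_zero_of_triple_eq_zero {n a b x : Fin 3 → ℝ} (hab : a ⨯₃ b ≠ 0)
    (hx : a ⬝ᵥ b ⨯₃ x = 0) (ha : n ⬝ᵥ a = 0) (hb : n ⬝ᵥ b = 0) : n ⬝ᵥ x = 0 := by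
  by_contra hn
  refine hab (funext fun i => (mul_eq_zero.1 ?_).resolve_left hn)
  simp only [Matrix.vec3_dotProduct, cross_apply] at *
  simp only [Fin.isValue, Matrix.cons_val_zero, Matrix.cons_val_one, Matrix.cons_val] at hx
  fin_cases i <;>
    simp only [Fin.zero_eta, Fin.mk_one, Fin.reduceFinMk, Fin.isValue, Matrix.cons_val_zero,
      Matrix.cons_val_one, Matrix.cons_val]
  · linear_combination n 0 * hx + (x 1 * b 2 - x 2 * b 1) * ha - (x 1 * a 2 - x 2 * a 1) * hb
  · linear_combination n 1 * hx + (x 2 * b 0 - x 0 * b 2) * ha - (x 2 * a 0 - x 0 * a 2) * hb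
  · linear_combination n 2 * hx + (x 0 * b 1 - x 1 * b 0) * ha - (x 0 * a 1 - x 1 * a 0) * hb

namespace IsCollineationLift

variable {F : (Fin 3 → ℝ) → (Fin 3 → ℝ)}

theorem map_comp (hF : IsCollineationLift F) (e : (Fin 3 → ℝ) ≃ₗ[ℝ] (Fin 3 → ℝ)) :
    IsCollineationLift (fun v => e (F v)) where
  ne_zero v hv := e.map_ne_zero_iff.2 (hF.ne_zero v hv)
  cross_eq_zero u v h := hF.cross_eq_zero u v ((cross_map_eq_zero_iff e).1 h)
  triple_eq_zero u v w h := (triple_map_eq_zero_iff e).2 (hF.triple_eq_zero u v w h)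

/-- Surjectivity forces noncollinear points to have noncollinear images: otherwise the whole
plane would be mapped into a line. -/
theorem triple_ne_zero (hF : IsCollineationLift F)
    (hsurj : ∀ y, y ≠ 0 → ∃ x, ∃ c : ℝ, y = c • F x) {u v w : Fin 3 → ℝ}
    (h : u ⬝ᵥ v ⨯₃ w ≠ 0) : F u ⬝ᵥ F v ⨯₃ F w ≠ 0 := by
  intro h0
  have hline : ∀ n a b x, a ⨯₃ b ≠ 0 → a ⬝ᵥ b ⨯₃ x = 0 → n ⬝ᵥ F a = 0 → n ⬝ᵥ F b = 0 →
      n ⬝ᵥ F x = 0 := fun n a b x hab hx ha hb =>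
    dotProduct_eq_zero_of_triple_eq_zero (mt (hF.cross_eq_zero a b) hab)
      (hF.triple_eq_zero a b x hx) ha hb
  have hwuv : w ⬝ᵥ u ⨯₃ v ≠ 0 := by rwa [triple_product_permutation]
  have huv : u ⨯₃ v ≠ 0 := fun h1 => hwuv (by rw [h1, dotProduct_zero])
  have huw : u ⨯₃ w ≠ 0 := by
    rw [← cross_anticomm, neg_ne_zero]
    exact fun h1 => h (by rw [triple_product_permutation, h1, dotProduct_zero])
  have hn : F u ⨯₃ F v ≠ 0 := mt (hF.cross_eq_zero u v) huv
  set n := F u ⨯₃ F v with hn_def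
  have hnu : n ⬝ᵥ F u = 0 := by rw [dotProduct_comm]; exact dot_self_cross _ _
  have hnv : n ⬝ᵥ F v = 0 := by rw [dotProduct_comm]; exact dot_cross_self _ _
  have hnw : n ⬝ᵥ F w = 0 := by
    rw [dotProduct_comm, hn_def, triple_product_permutation]; exact h0
  have hall : ∀ x, n ⬝ᵥ F x = 0 := by
    intro x
    by_cases hwx : w ⨯₃ x = 0
    · exact hline n u w x huw (by rw [hwx, dotProduct_zero]) hnu hnw
    have hyw : (u ⨯₃ v) ⨯₃ (w ⨯₃ x) ⨯₃ w ≠ 0 := by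
      rw [cross_cross_eq_smul_sub_smul, dotProduct_comm (w ⨯₃ x), dot_self_cross, zero_smul,
        sub_zero, dotProduct_comm]
      exact smul_ne_zero hwuv hwx
    refine hline n _ w x hyw ?_ (hline n u v _ huv ?_ hnu hnv) hnw
    · rw [dotProduct_comm, dot_cross_self]
    · rw [triple_product_permutation, triple_product_permutation, dotProduct_comm, dot_self_cross]
  obtain ⟨x, c, hx⟩ := hsurj n hn
  have : n ⬝ᵥ n = 0 := by
    nth_rw 2 [hx]
    rw [dotProduct_smul, hall, smul_zero]
  exact hn (dotProduct_self_eq_zero.1 this)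

/-- A collinearity preserving injection of the projective plane that fixes the four points of the
standard projective frame is the identity. -/
theorem cross_self_eq_zero_of_frame (hF : IsCollineationLift F)
    (h₁ : F ![1, 0, 0] ⨯₃ ![1, 0, 0] = 0) (h₂ : F ![0, 1, 0] ⨯₃ ![0, 1, 0] = 0)
    (h₃ : F ![0, 0, 1] ⨯₃ ![0, 0, 1] = 0) (h₄ : F ![1, 1, 1] ⨯₃ ![1, 1, 1] = 0)
    (v : Fin 3 → ℝ) : F v ⨯₃ v = 0 := by
  have coords_ne : ∀ {w : Fin 3 → ℝ}, w ≠ 0 → F w 0 = 0 → F w 1 = 0 → F w 2 ≠ 0 := by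
    intro w hw h0 h1 h2
    exact hF.ne_zero w hw (by ext i; fin_cases i <;> assumption)
  simp [cross_apply] at h₁ h₂ h₃ h₄
  obtain ⟨h12, h11⟩ := h₁
  obtain ⟨h22, h20⟩ := h₂
  obtain ⟨h31, h30⟩ := h₃
  obtain ⟨h41, h42, h40⟩ := h₄
  have h10 : F ![1, 0, 0] 0 ≠ 0 := fun h => coords_ne (by simp) h h11 h12
  have h21 : F ![0, 1, 0] 1 ≠ 0 := fun h => coords_ne (by simp) h20 h h22
  have h32 : F ![0, 0, 1] 2 ≠ 0 := coords_ne (by simp) h30 h31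
  have h43 : F ![1, 1, 1] 2 ≠ 0 := fun h =>
    coords_ne (by simp) (by linarith) (by linarith) h
  have tri : ∀ a b c : Fin 3 → ℝ, a ⬝ᵥ b ⨯₃ c = 0 →
      F a 0 * (F b 1 * F c 2 - F b 2 * F c 1) + F a 1 * (F b 2 * F c 0 - F b 0 * F c 2)
        + F a 2 * (F b 0 * F c 1 - F b 1 * F c 0) = 0 := by
    intro a b c h
    have := hF.triple_eq_zero a b c h
    rwa [cross_apply, Matrix.vec3_dotProduct] at this
  have axis₁ : ∀ x, F ![x, 0, 1] 1 = 0 := by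
    intro x
    have h := tri ![x, 0, 1] ![1, 0, 0] ![0, 0, 1] (by simp [cross_apply])
    rw [h11, h12, h30, h31] at h
    have : F ![x, 0, 1] 1 * (F ![1, 0, 0] 0 * F ![0, 0, 1] 2) = 0 := by linear_combination -h
    exact (mul_eq_zero.1 this).resolve_right (mul_ne_zero h10 h32)
  have axis₂ : ∀ y, F ![0, y, 1] 0 = 0 := by
    intro y
    have h := tri ![0, y, 1] ![0, 1, 0] ![0, 0, 1] (by simp [cross_apply])
    rw [h20, h22, h30, h31] at h
    have : F ![0, y, 1] 0 * (F ![0, 1, 0] 1 * F ![0, 0, 1] 2) = 0 := by linear_combination h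
    exact (mul_eq_zero.1 this).resolve_right (mul_ne_zero h21 h32)
  have axis₁_ne : ∀ x, F ![x, 0, 1] 2 ≠ 0 := by
    intro x h
    have := hF.cross_eq_zero ![x, 0, 1] ![1, 0, 0] (by simp [cross_apply, h, axis₁, h11, h12])
    simp [cross_apply] at this
  have axis₂_ne : ∀ y, F ![0, y, 1] 2 ≠ 0 := by
    intro y h
    have := hF.cross_eq_zero ![0, y, 1] ![0, 1, 0] (by simp [cross_apply, h, axis₂, h20, h22])
    simp [cross_apply] at this
  obtain ⟨φ, hφ⟩ : ∃ φ : ℝ → ℝ, ∀ x, F ![x, 0, 1] 0 = φ x * F ![x, 0, 1] 2 :=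
    ⟨fun x => F ![x, 0, 1] 0 / F ![x, 0, 1] 2, fun x => (div_mul_cancel₀ _ (axis₁_ne x)).symm⟩
  obtain ⟨ψ, hψ⟩ : ∃ ψ : ℝ → ℝ, ∀ y, F ![0, y, 1] 1 = ψ y * F ![0, y, 1] 2 :=
    ⟨fun y => F ![0, y, 1] 1 / F ![0, y, 1] 2, fun y => (div_mul_cancel₀ _ (axis₂_ne y)).symm⟩
  have affine₁ : ∀ x y, F ![x, y, 1] 0 = φ x * F ![x, y, 1] 2 := by
    intro x y
    have h := tri ![x, y, 1] ![0, 1, 0] ![x, 0, 1] (by simp [cross_apply])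
    rw [h20, h22, axis₁, hφ] at h
    refine mul_right_cancel₀ (mul_ne_zero h21 (axis₁_ne x)) ?_
    linear_combination h
  have affine₂ : ∀ x y, F ![x, y, 1] 1 = ψ y * F ![x, y, 1] 2 := by
    intro x y
    have h := tri ![x, y, 1] ![1, 0, 0] ![0, y, 1] (by simp [cross_apply])
    rw [h11, h12, axis₂, hψ] at h
    refine mul_right_cancel₀ (mul_ne_zero h10 (axis₂_ne y)) ?_
    linear_combination -h
  have affine_ne : ∀ x y, F ![x, y, 1] 2 ≠ 0 := by
    intro x y h
    refine coords_ne (w := ![x, y, 1]) (by simp) ?_ ?_ h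
    · rw [affine₁, h, mul_zero]
    · rw [affine₂, h, mul_zero]
  have hψφ : ∀ x, ψ x = φ x := by
    intro x
    have h := tri ![x, x, 1] ![0, 0, 1] ![1, 1, 1] (by simp [cross_apply])
    rw [h30, h31, affine₁, affine₂ x x] at h
    have h41' : F ![1, 1, 1] 0 = F ![1, 1, 1] 2 := by linarith
    have h42' : F ![1, 1, 1] 1 = F ![1, 1, 1] 2 := by linarith
    rw [h41', h42'] at h
    refine mul_right_cancel₀ (mul_ne_zero (affine_ne x x) (mul_ne_zero h32 h43)) ?_
    linear_combination h
  simp only [hψφ] at affine₂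
  clear hψ hψφ
  have triple_affine : ∀ a a' b b' c c' : ℝ,
      ![a, a', 1] ⬝ᵥ ![b, b', 1] ⨯₃ ![c, c', 1] = 0 →
      φ a * (φ b' - φ c') + φ a' * (φ c - φ b) + (φ b * φ c' - φ b' * φ c) = 0 := by
    intro a a' b b' c c' h
    have h := tri _ _ _ h
    simp only [affine₁, affine₂] at h
    refine (mul_eq_zero.1 (?_ : F ![a, a', 1] 2 * (F ![b, b', 1] 2 * F ![c, c', 1] 2) * _ = 0)
      ).resolve_left (mul_ne_zero (affine_ne _ _) (mul_ne_zero (affine_ne _ _) (affine_ne _ _)))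
    linear_combination h
  have φ_zero : φ 0 = 0 := by
    have := affine₁ 0 0
    rw [h30, eq_comm] at this
    exact (mul_eq_zero.1 this).resolve_right h32
  have φ_one : φ 1 = 1 := by
    refine mul_right_cancel₀ h43 ?_
    rw [← affine₁]
    linarith
  have φ_mul : ∀ m t, φ (m * t) = φ m * φ t := by
    intro m t
    have h := triple_affine 0 0 1 m t (m * t) (by simp [cross_apply])
    rw [φ_zero, φ_one] at h
    linear_combination h
  have at_infinity : ∀ x y, F ![x, y, 0] 2 = 0 := by
    intro x y
    have h := tri ![x, y, 0] ![1, 0, 0] ![0, 1, 0] (by simp [cross_apply])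
    rw [h11, h12, h20, h22] at h
    have : F ![x, y, 0] 2 * (F ![1, 0, 0] 0 * F ![0, 1, 0] 1) = 0 := by linear_combination h
    exact (mul_eq_zero.1 this).resolve_right (mul_ne_zero h10 h21)
  have slope : ∀ x y, F ![x, y, 0] 0 * φ y = F ![x, y, 0] 1 * φ x := by
    intro x y
    have h := tri ![x, y, 0] ![0, 0, 1] ![x, y, 1] (by
      simp [cross_apply]; ring)
    rw [h30, h31, at_infinity, affine₁, affine₂] at h
    refine mul_right_cancel₀ (mul_ne_zero h32 (affine_ne x y)) ?_
    linear_combination -h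
  have φ_add : ∀ a t, φ (a + t) = φ a + φ t := by
    intro a t
    have hd := slope 1 1
    rw [φ_one, mul_one, mul_one] at hd
    have hd0 : F ![1, 1, 0] 1 ≠ 0 := fun h =>
      coords_ne (w := ![1, 1, 0]) (by simp) (hd.trans h) h (at_infinity 1 1)
    have h := tri ![a, 0, 1] ![a + t, t, 1] ![1, 1, 0] (by simp [cross_apply])
    rw [hd, at_infinity, axis₁, affine₁, affine₁, affine₂] at h
    refine mul_right_cancel₀ (mul_ne_zero hd0 (mul_ne_zero (affine_ne a 0) (affine_ne (a + t) t))) ?_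
    linear_combination h
  have φ_id : ∀ x, φ x = x := by
    let Φ : ℝ →+* ℝ :=
      { toFun := φ, map_one' := φ_one, map_mul' := φ_mul, map_zero' := φ_zero, map_add' := φ_add }
    exact fun x => congrArg (fun g : ℝ →+* ℝ => g x) (Subsingleton.elim Φ (RingHom.id ℝ))
  simp only [φ_id] at affine₁ affine₂ slope
  obtain ⟨x, y, z, rfl⟩ : ∃ x y z, v = ![x, y, z] :=
    ⟨v 0, v 1, v 2, by ext i; fin_cases i <;> rfl⟩
  by_cases hz : z = 0
  · subst hz
    have := slope x y
    simp [cross_apply, at_infinity, this]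
  · obtain ⟨X, rfl⟩ : ∃ X, x = z * X := ⟨x / z, (mul_div_cancel₀ x hz).symm⟩
    obtain ⟨Y, rfl⟩ : ∃ Y, y = z * Y := ⟨y / z, (mul_div_cancel₀ y hz).symm⟩
    have t₁ := tri ![z * X, z * Y, z] ![X, Y, 1] ![1, 0, 0] (by simp [cross_apply])
    have t₂ := tri ![z * X, z * Y, z] ![X, Y, 1] ![0, 1, 0] (by simp [cross_apply])
    rw [h11, h12, affine₁, affine₂] at t₁
    rw [h20, h22, affine₁, affine₂] at t₂
    have e₁ : F ![z * X, z * Y, z] 1 = F ![z * X, z * Y, z] 2 * Y := by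
      refine mul_right_cancel₀ (mul_ne_zero h10 (affine_ne X Y)) ?_
      linear_combination t₁
    have e₂ : F ![z * X, z * Y, z] 0 = F ![z * X, z * Y, z] 2 * X := by
      refine mul_right_cancel₀ (mul_ne_zero h21 (affine_ne X Y)) ?_
      linear_combination -t₂
    ext i
    fin_cases i <;> simp [cross_apply, e₁, e₂] <;> ring

/-- A collinearity preserving bijection of the projective plane is induced by an invertible
linear map, in terms of representing vectors. -/
theorem exists_linearEquiv (hF : IsCollineationLift F)
    (hsurj : ∀ y, y ≠ 0 → ∃ x, ∃ c : ℝ, y = c • F x) :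
    ∃ M : (Fin 3 → ℝ) ≃ₗ[ℝ] (Fin 3 → ℝ), ∀ v, F v ⨯₃ M v = 0 := by
  have h := hF.triple_ne_zero hsurj (u := ![1, 0, 0]) (v := ![0, 1, 0]) (w := ![0, 0, 1])
    (by simp [cross_apply])
  have h₁ := hF.triple_ne_zero hsurj (u := ![1, 1, 1]) (v := ![0, 1, 0]) (w := ![0, 0, 1])
    (by simp [cross_apply])
  have h₂ := hF.triple_ne_zero hsurj (u := ![1, 0, 0]) (v := ![1, 1, 1]) (w := ![0, 0, 1])
    (by simp [cross_apply])
  have h₃ := hF.triple_ne_zero hsurj (u := ![1, 0, 0]) (v := ![0, 1, 0]) (w := ![1, 1, 1])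
    (by simp [cross_apply])
  set p := F ![1, 0, 0] with hp
  set q := F ![0, 1, 0] with hq
  set r := F ![0, 0, 1] with hr
  set s := F ![1, 1, 1] with hs
  set a := s ⬝ᵥ q ⨯₃ r with ha
  set b := p ⬝ᵥ s ⨯₃ r with hb
  set c := p ⬝ᵥ q ⨯₃ s with hc
  have hli : LinearIndependent ℝ ![a • p, b • q, c • r] := by
    rw [← triple_ne_zero_iff_linearIndependent]
    simp only [map_smul, LinearMap.smul_apply, smul_dotProduct, dotProduct_smul]
    exact smul_ne_zero h₃ (smul_ne_zero h₂ (smul_ne_zero h₁ h))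
  let B := basisOfLinearIndependentOfCardEqFinrank hli (by simp)
  let M := (Pi.basisFun ℝ (Fin 3)).equiv B (Equiv.refl _)
  have hM : ∀ x y z : ℝ, M ![x, y, z] = x • a • p + y • b • q + z • c • r := by
    intro x y z
    have hB : ∀ i, M (Pi.single i 1) = ![a • p, b • q, c • r] i := by
      intro i
      rw [← Pi.basisFun_apply, Module.Basis.equiv_apply]
      simp [B]
    have hxyz : ![x, y, z] = x • Pi.single 0 1 + y • Pi.single 1 1 + z • Pi.single 2 1 := by
      ext i
      fin_cases i <;> simp
    rw [hxyz, map_add, map_add, map_smul, map_smul, map_smul, hB, hB, hB]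
    rfl
  have cramer : a • p + b • q + c • r = (p ⬝ᵥ q ⨯₃ r) • s := by
    simp only [ha, hb, hc, cross_apply, Matrix.vec3_dotProduct]
    ext i
    fin_cases i <;> simp <;> ring
  have key : ∀ v, M.symm (F v) ⨯₃ v = 0 ↔ F v ⨯₃ M v = 0 := by
    intro v
    rw [← cross_map_eq_zero_iff M, M.apply_symm_apply]
  refine ⟨M, fun v => (key v).1 ((hF.map_comp M.symm).cross_self_eq_zero_of_frame ?_ ?_ ?_ ?_ v)⟩
  · rw [key, hM, ← hp]; simp
  · rw [key, hM, ← hq]; simp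
  · rw [key, hM, ← hr]; simp
  · rw [key, hM, one_smul, one_smul, one_smul, cramer, ← hs]; simp

end IsCollineationLift

theorem projCollinear_iff_triple_eq_zero {p q r : ℙ ℝ (Fin 3 → ℝ)} :
    ProjCollinear {p, q, r} ↔ p.rep ⬝ᵥ q.rep ⨯₃ r.rep = 0 := by
  have hrange : ∀ W : Submodule ℝ (Fin 3 → ℝ), Submodule.span ℝ (Set.range ![p.rep, q.rep, r.rep])
      ≤ W ↔ ∀ x ∈ ({p, q, r} : Set (ℙ ℝ (Fin 3 → ℝ))), x.rep ∈ W := by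
    intro W
    rw [Submodule.span_le, Set.range_subset_iff, Fin.forall_fin_succ, Fin.forall_fin_two]
    simp
  rw [← not_iff_not, ← ne_eq (_ ⬝ᵥ _), triple_ne_zero_iff_linearIndependent,
    linearIndependent_iff_card_le_finrank_span, Fintype.card_fin, not_iff_comm, not_le]
  constructor
  · exact fun h => ⟨_, Nat.lt_succ_iff.1 h, (hrange _).1 le_rfl⟩
  · rintro ⟨W, hW, hmem⟩
    exact Nat.lt_succ_iff.2 ((Submodule.finrank_mono ((hrange W).2 hmem)).trans hW)

theorem projCollinear_mk_iff {u v w : Fin 3 → ℝ} (hu : u ≠ 0) (hv : v ≠ 0) (hw : w ≠ 0) :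
    ProjCollinear {mk ℝ u hu, mk ℝ v hv, mk ℝ w hw} ↔ u ⬝ᵥ v ⨯₃ w = 0 := by
  obtain ⟨a, ha⟩ := exists_smul_eq_mk_rep ℝ u hu
  obtain ⟨b, hb⟩ := exists_smul_eq_mk_rep ℝ v hv
  obtain ⟨c, hc⟩ := exists_smul_eq_mk_rep ℝ w hw
  rw [projCollinear_iff_triple_eq_zero, ← ha, ← hb, ← hc]
  simp [Units.smul_def]

open Classical in
/-- The map on vectors sending each `v ≠ 0` to a representative of the image under `f` of the
point represented by `v`, and `0` to `0`. -/
noncomputable def vectorLift (f : ℙ ℝ (Fin 3 → ℝ) → ℙ ℝ (Fin 3 → ℝ)) (v : Fin 3 → ℝ) :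
    Fin 3 → ℝ :=
  if hv : v = 0 then 0 else (f (mk ℝ v hv)).rep

theorem vectorLift_zero (f : ℙ ℝ (Fin 3 → ℝ) → ℙ ℝ (Fin 3 → ℝ)) : vectorLift f 0 = 0 :=
  dif_pos rfl

theorem vectorLift_of_ne_zero (f : ℙ ℝ (Fin 3 → ℝ) → ℙ ℝ (Fin 3 → ℝ)) {v : Fin 3 → ℝ}
    (hv : v ≠ 0) : vectorLift f v = (f (mk ℝ v hv)).rep :=
  dif_neg hv

theorem isCollineationLift_vectorLift {f : ℙ ℝ (Fin 3 → ℝ) → ℙ ℝ (Fin 3 → ℝ)}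
    (hinj : Function.Injective f)
    (hf : ∀ p q r : ℙ ℝ (Fin 3 → ℝ), ProjCollinear {p, q, r} →
      ProjCollinear {f p, f q, f r}) : IsCollineationLift (vectorLift f) where
  ne_zero v hv := by
    rw [vectorLift_of_ne_zero f hv]
    exact rep_nonzero _
  cross_eq_zero u v h := by
    rcases eq_or_ne u 0 with rfl | hu
    · simp
    rcases eq_or_ne v 0 with rfl | hv
    · simp
    rw [vectorLift_of_ne_zero f hu, vectorLift_of_ne_zero f hv,
      ← mk_eq_mk_iff_crossProduct_eq_zero (rep_nonzero _) (rep_nonzero _), mk_rep, mk_rep] at h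
    exact (mk_eq_mk_iff_crossProduct_eq_zero hu hv).1 (hinj h)
  triple_eq_zero u v w h := by
    rcases eq_or_ne u 0 with rfl | hu
    · simp [vectorLift_zero]
    rcases eq_or_ne v 0 with rfl | hv
    · simp [vectorLift_zero]
    rcases eq_or_ne w 0 with rfl | hw
    · simp [vectorLift_zero]
    rw [vectorLift_of_ne_zero f hu, vectorLift_of_ne_zero f hv, vectorLift_of_ne_zero f hw,
      ← projCollinear_iff_triple_eq_zero]
    exact hf _ _ _ ((projCollinear_mk_iff hu hv hw).2 h)

end CollinearityPreserving

/-- Every bijection of the real projective plane mapping collinear points to collinear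
points is a homography, i.e. is induced by an invertible linear map of `ℝ³`. -/
theorem collineation_is_homography
    (f : ℙ ℝ (Fin 3 → ℝ) ≃ ℙ ℝ (Fin 3 → ℝ))
    (hf : ∀ p q r : ℙ ℝ (Fin 3 → ℝ), ProjCollinear {p, q, r} →
      ProjCollinear {f p, f q, f r}) :
    ∃ M : (Fin 3 → ℝ) ≃ₗ[ℝ] (Fin 3 → ℝ),
      ∀ (v : Fin 3 → ℝ) (hv : v ≠ 0),
        f (Projectivization.mk ℝ v hv) =
          Projectivization.mk ℝ (M v) (M.map_ne_zero_iff.mpr hv) := by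
  obtain ⟨M, hM⟩ := (isCollineationLift_vectorLift f.injective hf).exists_linearEquiv (by
    intro y hy
    have hne : (f.symm (mk ℝ y hy)).rep ≠ 0 := rep_nonzero _
    obtain ⟨c, hc⟩ := exists_smul_eq_mk_rep ℝ y hy
    refine ⟨(f.symm (mk ℝ y hy)).rep, ↑c⁻¹, ?_⟩
    rw [vectorLift_of_ne_zero f hne, mk_rep, f.apply_symm_apply, ← hc, ← Units.smul_def,
      inv_smul_smul])
  refine ⟨M, fun v hv => ?_⟩
  have h := hM v
  rwa [vectorLift_of_ne_zero f hv, ← mk_eq_mk_iff_crossProduct_eq_zero (rep_nonzero _)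
    (M.map_ne_zero_iff.mpr hv), mk_rep] at h
end
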